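/- Let Γ_n be the directed graph of isomorphism classes of cubic graphs on 2n vertices connected by Whitehead moves, and let B_n ⊆ V(Γ_n) be the set of bridged cubic graphs. Then the number of directed edges of Γ_n from B_n to V(Γ_n) ∖ B_n satisfies |∂(B_n)| ≤ 2|B_n|. -/

import Mathlib

/-! Cubic multigraphs in the dart (half-edge) model, Whitehead moves,
and the "graph of graphs" `Γ_n`. -/

/-- A cubic multigraph on the `2 * n` vertices `Fin (2 * n)`, in the dart (half-edge) model:
darts are `Fin (6 * n)`, `dinv` is the fixed-point-free involution exchanging the two darts of
each edge, and `vert` assigns to each dart its base vertex.  Loops and multiple edges are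
allowed; `regular` says every vertex carries exactly three darts. -/
structure CubicGraph (n : ℕ) where
  vert : Fin (6 * n) → Fin (2 * n)
  dinv : Fin (6 * n) → Fin (6 * n)
  dinv_invol : ∀ d, dinv (dinv d) = d
  dinv_ne : ∀ d, dinv d ≠ d
  regular : ∀ v : Fin (2 * n), (Finset.univ.filter fun d => vert d = v).card = 3

namespace CubicGraph

variable {n : ℕ}

/-- Two darts are joined if they can be connected by a chain of
"same vertex" / "other half of the same edge" steps. -/
def Reach (g : CubicGraph n) : Fin (6 * n) → Fin (6 * n) → Prop :=
  Relation.ReflTransGen fun a b => g.vert a = g.vert b ∨ g.dinv a = b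

/-- Connectivity of a cubic multigraph. -/
def Connected (g : CubicGraph n) : Prop := ∀ d d', g.Reach d d'

/-- The edge of the dart `d` is a loop. -/
def IsLoop (g : CubicGraph n) (d : Fin (6 * n)) : Prop := g.vert (g.dinv d) = g.vert d

instance (g : CubicGraph n) (d : Fin (6 * n)) : Decidable (g.IsLoop d) :=
  inferInstanceAs (Decidable (_ = _))

lemma card_filter_comp_swap (g : CubicGraph n) (q r : Fin (6 * n)) (v : Fin (2 * n)) :
    (Finset.univ.filter fun d => g.vert (Equiv.swap q r d) = v).card
      = (Finset.univ.filter fun d => g.vert d = v).card := by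
  refine Finset.card_bij (fun d _ => Equiv.swap q r d) ?_ ?_ ?_
  · intro a ha
    simp only [Finset.mem_filter, Finset.mem_univ, true_and] at ha ⊢
    exact ha
  · intro a _ b _ h
    exact (Equiv.swap q r).injective h
  · intro b hb
    simp only [Finset.mem_filter, Finset.mem_univ, true_and] at hb
    exact ⟨Equiv.swap q r b, by simp [hb], by simp⟩

/-- Exchange the base vertices of the two darts `q` and `r`, keeping everything else. -/
def swapDarts (g : CubicGraph n) (q r : Fin (6 * n)) : CubicGraph n where
  vert := fun d => g.vert (Equiv.swap q r d)
  dinv := g.dinv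
  dinv_invol := g.dinv_invol
  dinv_ne := g.dinv_ne
  regular := fun v => (g.card_filter_comp_swap q r v).trans (g.regular v)

/-- The darts based at the same vertex as `x`, other than `x` itself. -/
def othersAt (g : CubicGraph n) (x : Fin (6 * n)) : Finset (Fin (6 * n)) :=
  (Finset.univ.filter fun d => g.vert d = g.vert x).erase x

lemma othersAt_nonempty (g : CubicGraph n) (x : Fin (6 * n)) :
    (g.othersAt x).Nonempty := by
  have hx : x ∈ Finset.univ.filter fun d => g.vert d = g.vert x := by simp
  have h : (g.othersAt x).card = 2 := by
    rw [othersAt, Finset.card_erase_of_mem hx, g.regular]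
  rw [← Finset.card_pos, h]
  norm_num

def oMin (g : CubicGraph n) (x : Fin (6 * n)) : Fin (6 * n) :=
  (g.othersAt x).min' (g.othersAt_nonempty x)

def oMax (g : CubicGraph n) (x : Fin (6 * n)) : Fin (6 * n) :=
  (g.othersAt x).max' (g.othersAt_nonempty x)

/-- The two Whitehead moves (indexed by `i : Fin 2`) performed on the edge containing the dart
`x`.  On a loop the move leaves the graph unchanged; on a non-loop edge the two darts at the
endpoints of the edge other than the edge's own darts are re-attached in one of the two
possible new ways (realized by transporting one dart from each endpoint to the other). -/
def wh (g : CubicGraph n) (i : Fin 2) (x : Fin (6 * n)) : CubicGraph n :=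
  if g.IsLoop x then g
  else if i = 0 then g.swapDarts (g.oMax x) (g.oMin (g.dinv x))
  else g.swapDarts (g.oMax x) (g.oMax (g.dinv x))

/-- An isomorphism of cubic multigraphs: a bijection of darts together with a compatible
bijection of vertices, commuting with the edge involutions. -/
structure Iso (g₁ g₂ : CubicGraph n) where
  dartEquiv : Fin (6 * n) ≃ Fin (6 * n)
  vertEquiv : Fin (2 * n) ≃ Fin (2 * n)
  map_dinv : ∀ d, g₂.dinv (dartEquiv d) = dartEquiv (g₁.dinv d)
  map_vert : ∀ d, g₂.vert (dartEquiv d) = vertEquiv (g₁.vert d)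

def IsIsomorphic (g₁ g₂ : CubicGraph n) : Prop := Nonempty (Iso g₁ g₂)

/-- Reachability avoiding the edge of the dart `x` (i.e. in the graph with that edge removed). -/
def ReachAvoiding (g : CubicGraph n) (x : Fin (6 * n)) :
    Fin (6 * n) → Fin (6 * n) → Prop :=
  Relation.ReflTransGen fun a b =>
    g.vert a = g.vert b ∨ (g.dinv a = b ∧ a ≠ x ∧ a ≠ g.dinv x)

/-- The edge of `x` is a bridge: removing it disconnects the graph. -/
def IsBridge (g : CubicGraph n) (x : Fin (6 * n)) : Prop :=
  ¬ ∀ d d', g.ReachAvoiding x d d'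

/-- A (connected) graph is bridged if it has at least one bridge. -/
def Bridged (g : CubicGraph n) : Prop := ∃ x, g.IsBridge x

/-- A graph is bridgeless if it has no bridge. -/
def Bridgeless (g : CubicGraph n) : Prop := ∀ x, ¬ g.IsBridge x

/-- `c` lists consecutive darts of a cycle of length `k`: the vertices visited are pairwise
distinct, the end of each dart's edge is the base of the next one (cyclically), and the `k`
edges used are pairwise distinct. -/
def IsCycle (g : CubicGraph n) (k : ℕ) (c : Fin k → Fin (6 * n)) : Prop :=
  (∀ i : Fin k,
    g.vert (g.dinv (c i)) = g.vert (c ⟨(i.1 + 1) % k, Nat.mod_lt _ i.pos⟩)) ∧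
  Function.Injective (fun i => g.vert (c i)) ∧
  ∀ i j : Fin k, c j ≠ g.dinv (c i)

/-- The cycle `c` is indecomposable (induced): no edge of `g` other than the cycle's own
edges joins two vertices of the cycle. -/
def Indecomposable (g : CubicGraph n) (k : ℕ) (c : Fin k → Fin (6 * n)) : Prop :=
  ∀ d, (∃ i, g.vert d = g.vert (c i)) → (∃ j, g.vert (g.dinv d) = g.vert (c j)) →
    ∃ i, d = c i ∨ d = g.dinv (c i)

/-- The girth: the least length of a cycle. -/
noncomputable def girth (g : CubicGraph n) : ℕ :=
  sInf {k | 0 < k ∧ ∃ c : Fin k → Fin (6 * n), g.IsCycle k c}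

/-- The only cycles of the graph are loops. -/
def OnlyLoopCycles (g : CubicGraph n) : Prop :=
  ∀ k, 2 ≤ k → ∀ c : Fin k → Fin (6 * n), ¬ g.IsCycle k c

/-- The number of darts lying on loops (each loop contributes two darts). -/
def loopCount (g : CubicGraph n) : ℕ :=
  (Finset.univ.filter fun d => g.IsLoop d).card

end CubicGraph

instance {n : ℕ} : Finite (CubicGraph n) := by
  have hinj : Function.Injective fun g : CubicGraph n => (g.vert, g.dinv) := by
    rintro ⟨v₁, i₁, _, _, _⟩ ⟨v₂, i₂, _, _, _⟩ h
    simp only [Prod.mk.injEq] at h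
    obtain ⟨h₁, h₂⟩ := h
    subst h₁; subst h₂; rfl
  exact Finite.of_injective _ hinj

/-- Isomorphism of connected cubic graphs. -/
def cgIso {n : ℕ} (g₁ g₂ : {g : CubicGraph n // g.Connected}) : Prop :=
  CubicGraph.IsIsomorphic g₁.1 g₂.1

/-- The vertex set of the graph of graphs `Γ_n`: isomorphism classes of connected cubic
multigraphs on `2 * n` vertices. -/
abbrev GammaV (n : ℕ) := Quot (@cgIso n)

/-- The number of directed edges of `Γ_n` from the class `u` to the class `v`: one edge for
each Whitehead move of a representative of `u` whose result lies in the class `v`.  A move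
specification is a pair `(i, x)` of a move type `i : Fin 2` and a dart `x`; each of the two
Whitehead moves of each edge is counted by exactly two specifications (one for each of the
two darts of the edge), whence the division by `2`. -/
noncomputable def edgeMult (n : ℕ) (u v : GammaV n) : ℕ :=
  Nat.card {p : Fin 2 × Fin (6 * n) //
    CubicGraph.IsIsomorphic ((Quot.out u).1.wh p.1 p.2) (Quot.out v).1} / 2

/-- The sum of out-degrees of the classes in `S` (every class has out-degree `6 * n`:
two Whitehead moves for each of the `3 * n` edges). -/
noncomputable def dOut (n : ℕ) (S : Set (GammaV n)) : ℕ :=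
  Nat.card {q : GammaV n × Fin 2 × Fin (6 * n) // q.1 ∈ S} / 2

/-- The number of directed edges of `Γ_n` from `S` to its complement. -/
noncomputable def boundaryCount (n : ℕ) (S : Set (GammaV n)) : ℕ :=
  Nat.card {q : GammaV n × Fin 2 × Fin (6 * n) // q.1 ∈ S ∧
    ∀ v : GammaV n,
      CubicGraph.IsIsomorphic ((Quot.out q.1).1.wh q.2.1 q.2.2) (Quot.out v).1 → v ∉ S} / 2

/-- The outer conductance of a set `S` of vertices of `Γ_n`. -/
noncomputable def phiOutSet (n : ℕ) (S : Set (GammaV n)) : ℝ :=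
  (boundaryCount n S : ℝ) / min (dOut n S : ℝ) (dOut n Sᶜ : ℝ)

/-- The outer conductance of `Γ_n`: the infimum of the outer conductances of nonempty
proper subsets of vertices. -/
noncomputable def phiOut (n : ℕ) : ℝ :=
  sInf {x : ℝ | ∃ S : Set (GammaV n), S.Nonempty ∧ Sᶜ.Nonempty ∧ x = phiOutSet n S}

/-- The set of classes of bridged cubic graphs. -/
def bridgedSet (n : ℕ) : Set (GammaV n) := {u | (Quot.out u).1.Bridged}

namespace CubicGraph

variable {n : ℕ}

lemma IsIsomorphic.refl (g : CubicGraph n) : g.IsIsomorphic g :=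
  ⟨⟨Equiv.refl _, Equiv.refl _, fun _ => rfl, fun _ => rfl⟩⟩

lemma IsIsomorphic.symm {g h : CubicGraph n} : g.IsIsomorphic h → h.IsIsomorphic g := by
  rintro ⟨f⟩
  refine ⟨⟨f.dartEquiv.symm, f.vertEquiv.symm, fun d => ?_, fun d => ?_⟩⟩
  · rw [Equiv.eq_symm_apply, ← f.map_dinv, Equiv.apply_symm_apply]
  · rw [Equiv.eq_symm_apply, ← f.map_vert, Equiv.apply_symm_apply]

lemma IsIsomorphic.trans {g h k : CubicGraph n} :
    g.IsIsomorphic h → h.IsIsomorphic k → g.IsIsomorphic k := by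
  rintro ⟨f⟩ ⟨f'⟩
  exact ⟨⟨f.dartEquiv.trans f'.dartEquiv, f.vertEquiv.trans f'.vertEquiv,
    fun d => by simp [f'.map_dinv, f.map_dinv], fun d => by simp [f'.map_vert, f.map_vert]⟩⟩

lemma Iso.reachAvoiding {g h : CubicGraph n} (f : Iso g h) {x d d' : Fin (6 * n)}
    (hd : g.ReachAvoiding x d d') :
    h.ReachAvoiding (f.dartEquiv x) (f.dartEquiv d) (f.dartEquiv d') := by
  refine Relation.ReflTransGen.lift f.dartEquiv (fun a b hab => ?_) _ _ hd
  rcases hab with hab | ⟨hab, hx, hx'⟩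
  · left
    rw [f.map_vert, f.map_vert, hab]
  · right
    rw [f.map_dinv, f.map_dinv, hab]
    exact ⟨rfl, f.dartEquiv.injective.ne hx, f.dartEquiv.injective.ne hx'⟩

lemma Bridged.of_isIsomorphic {g h : CubicGraph n} (hg : g.Bridged) (e : g.IsIsomorphic h) :
    h.Bridged := by
  obtain ⟨f⟩ := e.symm
  obtain ⟨x, hx⟩ := hg
  refine ⟨f.dartEquiv.symm x, fun hall => hx fun d d' => ?_⟩
  simpa using f.reachAvoiding (hall (f.dartEquiv.symm d) (f.dartEquiv.symm d'))

lemma Reach.symm {g : CubicGraph n} {d d' : Fin (6 * n)} (h : g.Reach d d') : g.Reach d' d := by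
  refine (@Relation.ReflTransGen.stdSymm _ _ ⟨fun a b hab => ?_⟩).symm _ _ h
  rcases hab with hab | hab
  · exact Or.inl hab.symm
  · exact Or.inr (by rw [← hab, g.dinv_invol])

lemma ReachAvoiding.symm {g : CubicGraph n} {x d d' : Fin (6 * n)}
    (h : g.ReachAvoiding x d d') : g.ReachAvoiding x d' d := by
  refine (@Relation.ReflTransGen.stdSymm _ _ ⟨fun a b hab => ?_⟩).symm _ _ h
  rcases hab with hab | ⟨rfl, hx, hx'⟩
  · exact Or.inl hab.symm
  · refine Or.inr ⟨g.dinv_invol a, fun hax => hx' ?_, fun hax => hx ?_⟩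
    · rw [← hax, g.dinv_invol]
    · rw [← g.dinv_invol a, hax, g.dinv_invol]

lemma Reach.of_vert_eq {g : CubicGraph n} {d d' : Fin (6 * n)} (h : g.vert d = g.vert d') :
    g.Reach d d' :=
  .single (Or.inl h)

lemma Reach.dinv (g : CubicGraph n) (d : Fin (6 * n)) : g.Reach d (g.dinv d) :=
  .single (Or.inr rfl)

lemma ReachAvoiding.of_vert_eq {g : CubicGraph n} {x d d' : Fin (6 * n)}
    (h : g.vert d = g.vert d') : g.ReachAvoiding x d d' :=
  .single (Or.inl h)

lemma ReachAvoiding.dinv {g : CubicGraph n} {x d : Fin (6 * n)} (h : d ≠ x)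
    (h' : d ≠ g.dinv x) : g.ReachAvoiding x d (g.dinv d) :=
  .single (Or.inr ⟨rfl, h, h'⟩)

lemma rel_swap_apply {α : Type*} [DecidableEq α] {r : α → α → Prop} (hr : ∀ a, r a a)
    (hs : ∀ {a b}, r a b → r b a) {p q : α} (h : r p q) (d : α) : r d (Equiv.swap p q d) := by
  rcases eq_or_ne d p with rfl | hp
  · simpa using h
  · by_cases hq : d = q
    · subst hq
      simpa using hs h
    · rw [Equiv.swap_apply_of_ne_of_ne hp hq]
      exact hr d

/-- Exchanging darts at the two ends of the edge of `x` keeps every other bridge a bridge. -/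
lemma IsBridge.swapDarts {g : CubicGraph n} {b x q r : Fin (6 * n)} (hb : g.IsBridge b)
    (hx : x ≠ b) (hx' : x ≠ g.dinv b) (hq : g.vert q = g.vert x)
    (hr : g.vert r = g.vert (g.dinv x)) : (g.swapDarts q r).IsBridge b := by
  have hqr : g.ReachAvoiding b q r :=
    ((ReachAvoiding.of_vert_eq hq).trans (ReachAvoiding.dinv hx hx')).trans
      (ReachAvoiding.of_vert_eq hr.symm)
  have hswap : ∀ d, g.ReachAvoiding b d (Equiv.swap q r d) :=
    rel_swap_apply (r := g.ReachAvoiding b) (fun _ => .refl) ReachAvoiding.symm hqr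
  refine fun hall => hb fun d d' => ?_
  have h := hall d d'
  induction h with
  | refl => exact .refl
  | tail _ hab ih =>
    refine ih.trans ?_
    rcases hab with hab | hab
    · exact ((hswap _).tail (Or.inl hab)).trans (hswap _).symm
    · exact .single (Or.inr hab)

/-- Exchanging darts at the two ends of a non-loop edge preserves connectivity. -/
lemma Connected.swapDarts {g : CubicGraph n} {x q r : Fin (6 * n)} (hg : g.Connected)
    (hl : ¬ g.IsLoop x) (hq : g.vert q = g.vert x) (hqx : q ≠ x)
    (hr : g.vert r = g.vert (g.dinv x)) (hrx : r ≠ g.dinv x) :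
    (g.swapDarts q r).Connected := by
  have hl' : g.vert (g.dinv x) ≠ g.vert x := hl
  have hx : Equiv.swap q r x = x :=
    Equiv.swap_apply_of_ne_of_ne hqx.symm fun h => hl' (by rw [← hr, ← h])
  have hx' : Equiv.swap q r (g.dinv x) = g.dinv x :=
    Equiv.swap_apply_of_ne_of_ne (fun h => hl' (by rw [h, hq])) hrx.symm
  have hrq : (g.swapDarts q r).Reach r q := by
    have h₁ : (g.swapDarts q r).vert r = (g.swapDarts q r).vert x := by
      simp [CubicGraph.swapDarts, hx, hq]
    have h₂ : (g.swapDarts q r).vert (g.dinv x) = (g.swapDarts q r).vert q := by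
      simp [CubicGraph.swapDarts, hx', hr]
    exact ((Reach.of_vert_eq h₁).trans (Reach.dinv _ x)).trans (Reach.of_vert_eq h₂)
  have hswap : ∀ d, (g.swapDarts q r).Reach d (Equiv.swap q r d) :=
    rel_swap_apply (r := (g.swapDarts q r).Reach) (fun _ => .refl) Reach.symm hrq.symm
  intro d d'
  have h := hg d d'
  induction h with
  | refl => exact .refl
  | tail _ hab ih =>
    refine ih.trans ?_
    rcases hab with hab | hab
    · exact ((hswap _).tail (Or.inl (by simpa [CubicGraph.swapDarts] using hab))).trans
        (hswap _).symm
    · exact .single (Or.inr hab)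

lemma mem_othersAt {g : CubicGraph n} {x d : Fin (6 * n)} :
    d ∈ g.othersAt x ↔ d ≠ x ∧ g.vert d = g.vert x := by
  simp [othersAt]

lemma oMin_mem_othersAt (g : CubicGraph n) (x : Fin (6 * n)) : g.oMin x ∈ g.othersAt x :=
  Finset.min'_mem _ _

lemma oMax_mem_othersAt (g : CubicGraph n) (x : Fin (6 * n)) : g.oMax x ∈ g.othersAt x :=
  Finset.max'_mem _ _

/-- A Whitehead move is either trivial or exchanges two darts at the ends of its edge. -/
lemma wh_eq_or_exists_swapDarts (g : CubicGraph n) (i : Fin 2) (x : Fin (6 * n)) :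
    g.wh i x = g ∨ ¬ g.IsLoop x ∧ ∃ q ∈ g.othersAt x, ∃ r ∈ g.othersAt (g.dinv x),
      g.wh i x = g.swapDarts q r := by
  unfold wh
  split_ifs with hl
  · exact Or.inl rfl
  · exact Or.inr ⟨hl, _, g.oMax_mem_othersAt x, _, g.oMin_mem_othersAt _, rfl⟩
  · exact Or.inr ⟨hl, _, g.oMax_mem_othersAt x, _, g.oMax_mem_othersAt _, rfl⟩

lemma Connected.wh {g : CubicGraph n} (hg : g.Connected) (i : Fin 2) (x : Fin (6 * n)) :
    (g.wh i x).Connected := by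
  obtain h | ⟨hl, q, hq, r, hr, h⟩ := g.wh_eq_or_exists_swapDarts i x
  · rwa [h]
  · rw [mem_othersAt] at hq hr
    rw [h]
    exact hg.swapDarts hl hq.2 hq.1 hr.2 hr.1

lemma IsBridge.wh {g : CubicGraph n} {b x : Fin (6 * n)} (hb : g.IsBridge b) (hx : x ≠ b)
    (hx' : x ≠ g.dinv b) (i : Fin 2) : (g.wh i x).IsBridge b := by
  obtain h | ⟨-, q, hq, r, hr, h⟩ := g.wh_eq_or_exists_swapDarts i x
  · rwa [h]
  · rw [mem_othersAt] at hq hr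
    rw [h]
    exact hb.swapDarts hx hx' hq.2 hr.2

end CubicGraph

lemma cgIso_equivalence (n : ℕ) : Equivalence (@cgIso n) :=
  ⟨fun g => .refl g.1, fun h => h.symm, fun h h' => h.trans h'⟩

lemma isIsomorphic_out_mk {n : ℕ} (g : {g : CubicGraph n // g.Connected}) :
    g.1.IsIsomorphic (Quot.out (Quot.mk (@cgIso n) g)).1 :=
  ((cgIso_equivalence n).eqvGen_iff.mp (Quot.eqvGen_exact (Quot.out_eq (Quot.mk _ g)))).symm

/-- The number of directed edges of `Γ_n` from the set `B_n` of bridged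
classes to its complement is at most `2 * |B_n|`. -/
theorem boundary_of_bridged_le (n : ℕ) (hn : 1 ≤ n) :
    boundaryCount n (bridgedSet n) ≤ 2 * Nat.card (bridgedSet n) := by
  classical
  choose b hb using fun u : bridgedSet n => u.2
  have key : Nat.card {q : GammaV n × Fin 2 × Fin (6 * n) // q.1 ∈ bridgedSet n ∧
      ∀ v : GammaV n, CubicGraph.IsIsomorphic ((Quot.out q.1).1.wh q.2.1 q.2.2) (Quot.out v).1 →
        v ∉ bridgedSet n} ≤ Nat.card (bridgedSet n × Fin 2 × Bool) := by
    refine Nat.card_le_card_of_injective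
      (fun q => (⟨q.1.1, q.2.1⟩, q.1.2.1, decide (q.1.2.2 = b ⟨q.1.1, q.2.1⟩))) ?_
    have hmove : ∀ (u : bridgedSet n) (i : Fin 2) (x : Fin (6 * n)),
        (∀ v : GammaV n, CubicGraph.IsIsomorphic ((Quot.out u.1).1.wh i x) (Quot.out v).1 →
          v ∉ bridgedSet n) → x ≠ b u → x = (Quot.out u.1).1.dinv (b u) := by
      intro u i x hv hx
      by_contra hx'
      have hiso := isIsomorphic_out_mk ⟨_, (Quot.out u.1).2.wh i x⟩
      exact hv _ hiso (CubicGraph.Bridged.of_isIsomorphic ⟨b u, (hb u).wh hx hx' i⟩ hiso)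
    rintro ⟨⟨u, i, x⟩, hu, hv⟩ ⟨⟨u', i', x'⟩, hu', hv'⟩ h
    simp only [Prod.mk.injEq, Subtype.mk.injEq] at h
    obtain ⟨rfl, rfl, hxx'⟩ := h
    rw [decide_eq_decide] at hxx'
    have hxeq : x = x' := by
      by_cases hx : x = b ⟨u, hu⟩
      · exact hx.trans (hxx'.mp hx).symm
      · exact (hmove ⟨u, hu⟩ i x hv hx).trans
          (hmove ⟨u, hu⟩ i x' hv' (mt hxx'.mpr hx)).symm
    subst hxeq
    rfl
  simp only [Nat.card_prod, Nat.card_eq_fintype_card (α := Fin 2),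
    Nat.card_eq_fintype_card (α := Bool), Fintype.card_fin, Fintype.card_bool] at key
  unfold boundaryCount
  omega
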